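/- Let G be a graph on n vertices with maximum degree Δ and let λ > 0. Under the hard-core model at activity λ, the expected size of the random independent set satisfies E[|I|] ≥ nλ/(1 + (Δ+1)λ). Equivalently, (Σ_{I indep} |I|·λ^{|I|}) / (Σ_{I indep} λ^{|I|}) ≥ nλ/(1 + (Δ+1)λ). -/

import Mathlib

open Finset

/- The finset of all independent sets (as finsets of vertices) of a graph `G`. -/
open Classical in
noncomputable def indepFinsets {V : Type*} [Fintype V] (G : SimpleGraph V) :
    Finset (Finset V) :=
  Finset.univ.filter fun s => ∀ u ∈ s, ∀ v ∈ s, ¬ G.Adj u v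

open Classical in
/-- The vertices that are neither in `I` nor adjacent to a vertex of `I`. -/
noncomputable def freeVertices {V : Type*} [Fintype V] (G : SimpleGraph V) (I : Finset V) :
    Finset V :=
  Finset.univ.filter fun v => v ∉ I ∧ ∀ u ∈ I, ¬ G.Adj u v

theorem mem_freeVertices {V : Type*} [Fintype V] {G : SimpleGraph V} {I : Finset V} {v : V} :
    v ∈ freeVertices G I ↔ v ∉ I ∧ ∀ u ∈ I, ¬ G.Adj u v := by
  simp [freeVertices]

theorem mem_indepFinsets {V : Type*} [Fintype V] {G : SimpleGraph V} {I : Finset V} :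
    I ∈ indepFinsets G ↔ ∀ u ∈ I, ∀ v ∈ I, ¬ G.Adj u v := by
  simp [indepFinsets]

theorem empty_mem_indepFinsets {V : Type*} [Fintype V] (G : SimpleGraph V) :
    ∅ ∈ indepFinsets G := by
  simp [mem_indepFinsets]

/-- Removing a vertex from an independent set is inverse to adding a free one, so
`∑ |I| λ^|I| = λ ∑ |free vertices of I| λ^|I|`. -/
theorem sum_card_mul_pow_eq {V : Type*} [Fintype V] (G : SimpleGraph V) (lam : ℝ) :
    ∑ I ∈ indepFinsets G, (I.card : ℝ) * lam ^ I.card =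
      lam * ∑ I ∈ indepFinsets G, ((freeVertices G I).card : ℝ) * lam ^ I.card := by
  classical
  have expand : ∀ f : Finset V → Finset V,
      ∑ I ∈ indepFinsets G, ((f I).card : ℝ) * lam ^ I.card =
        ∑ p ∈ (indepFinsets G).sigma f, lam ^ p.1.card := by
    intro f
    simp [Finset.sum_sigma]
  rw [expand (fun I => I), expand (freeVertices G), Finset.mul_sum]
  refine Finset.sum_bij' (fun p _ => ⟨p.1.erase p.2, p.2⟩) (fun p _ => ⟨insert p.2 p.1, p.2⟩)
    ?_ ?_ ?_ ?_ ?_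
  · rintro ⟨I, v⟩ h
    simp only [Finset.mem_sigma, mem_indepFinsets, mem_freeVertices, Finset.mem_erase] at h ⊢
    exact ⟨fun u hu w hw => h.1 u hu.2 w hw.2, by simp, fun u hu => h.1 u hu.2 v h.2⟩
  · rintro ⟨I, v⟩ h
    simp only [Finset.mem_sigma, mem_indepFinsets, mem_freeVertices, Finset.mem_insert] at h ⊢
    obtain ⟨hI, -, hv⟩ := h
    refine ⟨?_, Or.inl trivial⟩
    rintro u (rfl | hu) w (rfl | hw)
    · exact G.irrefl
    · exact fun huw => hv w hw huw.symm
    · exact hv u hu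
    · exact hI u hu w hw
  · rintro ⟨I, v⟩ h
    simp only [Finset.mem_sigma] at h
    simp [Finset.insert_erase h.2]
  · rintro ⟨I, v⟩ h
    simp only [Finset.mem_sigma, mem_freeVertices] at h
    simp [Finset.erase_insert h.2.1]
  · rintro ⟨I, v⟩ h
    simp only [Finset.mem_sigma] at h
    rw [← Finset.card_erase_add_one h.2, pow_succ']

/-- Every vertex is free, or lies in the closed neighbourhood of a vertex of `I`. -/
theorem card_le_card_freeVertices_add {V : Type*} [Fintype V] (G : SimpleGraph V)
    [DecidableRel G.Adj] (I : Finset V) :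
    Fintype.card V ≤ (freeVertices G I).card + I.card * (G.maxDegree + 1) := by
  classical
  have cover : (Finset.univ : Finset V) ⊆
      freeVertices G I ∪ I.biUnion fun u => insert u (G.neighborFinset u) := by
    intro v _
    simp only [Finset.mem_union, mem_freeVertices, Finset.mem_biUnion, Finset.mem_insert,
      SimpleGraph.mem_neighborFinset]
    by_contra! h
    obtain ⟨u, hu, huv⟩ := h.1 fun hv => (h.2 v hv).1 rfl
    exact (h.2 u hu).2 huv
  calc Fintype.card V ≤ _ := Finset.card_le_card cover
    _ ≤ _ := Finset.card_union_le _ _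
    _ ≤ _ := by
      gcongr
      refine Finset.card_biUnion_le_card_mul _ _ _ fun u _ => (Finset.card_insert_le _ _).trans ?_
      rw [SimpleGraph.card_neighborFinset_eq_degree]
      exact Nat.add_le_add_right (G.degree_le_maxDegree u) 1

/-- For a graph `G` on `n` vertices with maximum degree `Δ` and `λ > 0`, the expected size
of a random independent set from the hard-core model satisfies
`E[|I|] = (Σ_I |I|λ^{|I|})/(Σ_I λ^{|I|}) ≥ nλ/(1+(Δ+1)λ)`. -/
theorem expected_size_lower_bound {V : Type*} [Fintype V] (G : SimpleGraph V)
    [DecidableRel G.Adj] (n Δ : ℕ) (hn : Fintype.card V = n)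
    (hΔ : G.maxDegree = Δ) (lam : ℝ) (hlam : 0 < lam) :
    (∑ I ∈ indepFinsets G, (I.card : ℝ) * lam ^ I.card) /
        (∑ I ∈ indepFinsets G, lam ^ I.card) ≥
      (n : ℝ) * lam / (1 + ((Δ : ℝ) + 1) * lam) := by
  subst hn hΔ
  have hP : 0 < ∑ I ∈ indepFinsets G, lam ^ I.card :=
    Finset.sum_pos (fun I _ => pow_pos hlam _) ⟨∅, empty_mem_indepFinsets G⟩
  have hfree : (Fintype.card V : ℝ) * ∑ I ∈ indepFinsets G, lam ^ I.card ≤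
      ∑ I ∈ indepFinsets G, ((freeVertices G I).card : ℝ) * lam ^ I.card +
        ((G.maxDegree : ℝ) + 1) * ∑ I ∈ indepFinsets G, (I.card : ℝ) * lam ^ I.card := by
    rw [Finset.mul_sum, Finset.mul_sum, ← Finset.sum_add_distrib]
    refine Finset.sum_le_sum fun I _ => ?_
    have h : (Fintype.card V : ℝ) ≤
        (freeVertices G I).card + I.card * ((G.maxDegree : ℝ) + 1) := by
      exact_mod_cast card_le_card_freeVertices_add G I
    calc _ ≤ _ := mul_le_mul_of_nonneg_right h (pow_nonneg hlam.le I.card)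
      _ = _ := by ring
  rw [ge_iff_le, div_le_div_iff₀ (by positivity) hP]
  linarith [mul_le_mul_of_nonneg_left hfree hlam.le, sum_card_mul_pow_eq G lam]
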